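/- For k = 2, the quantum determinant of the monodromy matrix is the explicit central scalar: for all u ∈ ℂ, (P⁻ ⊗ id_W) ∘ 𝒯₁₃(u−1) ∘ 𝒯₂₃(u+1) ∘ (P⁻ ⊗ id_W) = (∏_{j=1}^{N} (u − y_j + 3)(u − y_j − 1)) · (P⁻ ⊗ id_W), as endomorphisms of V₁ ⊗ V₂ ⊗ W, where P⁻ = (id − P)/2 is the antisymmetrizer on V₁ ⊗ V₂ and 𝒯ᵢ₃(u) denotes the monodromy matrix acting in the i-th auxiliary copy of V and the quantum space W. In particular the quantum determinant acts as a scalar on the quantum space, hence commutes with all matrix elements of 𝒯(v). -/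

import Mathlib

noncomputable section

/-- The permutation matrix `P` on `ℂ² ⊗ ℂ²` (basis indexed by `Fin 2 × Fin 2`):
`P (e_c ⊗ e_d) = e_d ⊗ e_c`. -/
def Pm : Matrix (Fin 2 × Fin 2) (Fin 2 × Fin 2) ℂ :=
  fun p q => if p.1 = q.2 ∧ p.2 = q.1 then 1 else 0

/-- The rational R-matrix `R(u) = u • id + 2 • P` on `ℂ² ⊗ ℂ²`. -/
noncomputable def Rm (u : ℂ) : Matrix (Fin 2 × Fin 2) (Fin 2 × Fin 2) ℂ :=
  u • (1 : Matrix (Fin 2 × Fin 2) (Fin 2 × Fin 2) ℂ) + (2 : ℂ) • Pm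

/-- The antisymmetrizer `P⁻ = (id − P)/2` on `ℂ² ⊗ ℂ²`. -/
noncomputable def Pminus : Matrix (Fin 2 × Fin 2) (Fin 2 × Fin 2) ℂ :=
  (2 : ℂ)⁻¹ • ((1 : Matrix (Fin 2 × Fin 2) (Fin 2 × Fin 2) ℂ) - Pm)

/-- Basis index of the space `V₀ ⊗ W`, `V₀ = ℂ²`, `W = (ℂ²)^{⊗N}`. -/
abbrev AuxQ (N : ℕ) := Fin 2 × (Fin N → Fin 2)

/-- `R₀ⱼ(u)`: the R-matrix acting on the auxiliary factor `V₀` and the `j`-th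
tensor factor of the quantum space `W`, identity elsewhere. -/
noncomputable def R0j (N : ℕ) (u : ℂ) (j : Fin N) : Matrix (AuxQ N) (AuxQ N) ℂ :=
  fun p q => Rm u (p.1, p.2 j) (q.1, q.2 j) *
    (if ∀ i : Fin N, i ≠ j → p.2 i = q.2 i then 1 else 0)

/-- The monodromy matrix `𝒯(u) = R₀N(u−y_N) ⋯ R₀₂(u−y₂) R₀₁(u−y₁)` on `V₀ ⊗ W`. -/
noncomputable def mono (N : ℕ) (y : Fin N → ℂ) (u : ℂ) : Matrix (AuxQ N) (AuxQ N) ℂ :=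
  ((List.ofFn (fun j : Fin N => R0j N (u - y j) j)).reverse).prod

/-- Basis index of `V₁ ⊗ V₂ ⊗ W`. -/
abbrev AAQ (N : ℕ) := Fin 2 × Fin 2 × (Fin N → Fin 2)

/-- `𝒯₁₃(u)`: monodromy matrix acting in the first auxiliary space and the quantum space. -/
noncomputable def T13 (N : ℕ) (y : Fin N → ℂ) (u : ℂ) : Matrix (AAQ N) (AAQ N) ℂ :=
  fun p q => mono N y u (p.1, p.2.2) (q.1, q.2.2) * (if p.2.1 = q.2.1 then 1 else 0)

/-- `𝒯₂₃(u)`: monodromy matrix acting in the second auxiliary space and the quantum space. -/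
noncomputable def T23 (N : ℕ) (y : Fin N → ℂ) (u : ℂ) : Matrix (AAQ N) (AAQ N) ℂ :=
  fun p q => mono N y u (p.2.1, p.2.2) (q.2.1, q.2.2) * (if p.1 = q.1 then 1 else 0)

/-- `P⁻ ⊗ id_W` acting on `V₁ ⊗ V₂ ⊗ W`. -/
noncomputable def PminusW (N : ℕ) : Matrix (AAQ N) (AAQ N) ℂ :=
  fun p q => Pminus (p.1, p.2.1) (q.1, q.2.1) * (if p.2.2 = q.2.2 then 1 else 0)

open Matrix

/-- The matrix of the operator `v ↦ v ∘ f` on `ℂ^n`. -/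
def compMatrix {n : Type*} [DecidableEq n] (f : n → n) : Matrix n n ℂ :=
  (1 : Matrix n n ℂ).submatrix f id

section compMatrix

variable {n : Type*} [DecidableEq n]

theorem compMatrix_apply (f : n → n) (p q : n) :
    compMatrix f p q = if f p = q then 1 else 0 := by
  simp [compMatrix, Matrix.one_apply]

theorem compMatrix_id : compMatrix (id : n → n) = 1 := rfl

theorem compMatrix_mul [Fintype n] (f g : n → n) :
    compMatrix f * compMatrix g = compMatrix (g ∘ f) := by
  ext p q
  simp only [Matrix.mul_apply, compMatrix_apply, ite_mul, one_mul, zero_mul, Finset.sum_ite_eq,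
    Finset.mem_univ, if_true, Function.comp_apply]

end compMatrix

/-- The embedding `A ↦ A ⊗ id` of matrices, along an identification `m ≃ n × k` of indices. -/
def tensorOneHom {m n k : Type*} [Fintype m] [DecidableEq m] [Fintype n] [DecidableEq n]
    [Fintype k] [DecidableEq k] (e : m ≃ n × k) : Matrix n n ℂ →* Matrix m m ℂ where
  toFun A := (kroneckerMap (· * ·) A (1 : Matrix k k ℂ)).submatrix e e
  map_one' := by simp
  map_mul' A B := by
    rw [submatrix_mul_equiv, ← mul_kronecker_mul, one_mul]

variable {N : ℕ}

/-- The identification `V₁ ⊗ V₂ ⊗ W ≃ (V₁ ⊗ W) ⊗ V₂` on basis indices. -/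
def splitSnd (N : ℕ) : AAQ N ≃ AuxQ N × Fin 2 where
  toFun p := ((p.1, p.2.2), p.2.1)
  invFun p := (p.1.1, p.2, p.1.2)

/-- The identification `V₁ ⊗ V₂ ⊗ W ≃ (V₂ ⊗ W) ⊗ V₁` on basis indices. -/
def splitFst (N : ℕ) : AAQ N ≃ AuxQ N × Fin 2 where
  toFun p := ((p.2.1, p.2.2), p.1)
  invFun p := (p.2, p.1.1, p.1.2)

theorem T13_eq (y : Fin N → ℂ) (u : ℂ) :
    T13 N y u = tensorOneHom (splitSnd N) (mono N y u) := by
  ext p q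
  simp [T13, tensorOneHom, splitSnd, Matrix.one_apply]

theorem T23_eq (y : Fin N → ℂ) (u : ℂ) :
    T23 N y u = tensorOneHom (splitFst N) (mono N y u) := by
  ext p q
  simp [T23, tensorOneHom, splitFst, Matrix.one_apply]

/-- Exchange of the two auxiliary indices. -/
def swap12 (p : AAQ N) : AAQ N := (p.2.1, p.1, p.2.2)

/-- Exchange of the first auxiliary index with the `j`-th quantum index. -/
def swap13 (j : Fin N) (p : AAQ N) : AAQ N :=
  (p.2.2 j, p.2.1, Function.update p.2.2 j p.1)

/-- Exchange of the second auxiliary index with the `j`-th quantum index. -/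
def swap23 (j : Fin N) (p : AAQ N) : AAQ N :=
  (p.1, p.2.2 j, Function.update p.2.2 j p.2.1)

theorem PminusW_eq :
    PminusW N = (2 : ℂ)⁻¹ • (1 - compMatrix swap12) := by
  ext ⟨a, b, w⟩ ⟨a', b', w'⟩
  by_cases h : w = w' <;>
    simp [PminusW, Pminus, Pm, swap12, compMatrix_apply, Matrix.one_apply, h, and_comm]

theorem forall_ne_eq_iff_update_eq {w w' : Fin N → Fin 2} {j : Fin N} {a : Fin 2} :
    (a = w' j ∧ ∀ i, i ≠ j → w i = w' i) ↔ Function.update w j a = w' :=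
  by rw [Function.update_eq_iff, eq_comm]

theorem R0j_eq (c : ℂ) (j : Fin N) :
    R0j N c j = c • (1 : Matrix (AuxQ N) (AuxQ N) ℂ) +
      (2 : ℂ) • compMatrix fun p : AuxQ N => (p.2 j, Function.update p.2 j p.1) := by
  ext ⟨a, w⟩ ⟨a', w'⟩
  have h1 : w = w' ↔ w j = w' j ∧ ∀ i, i ≠ j → w i = w' i := by
    rw [forall_ne_eq_iff_update_eq, Function.update_eq_self]
  simp only [R0j, Rm, Pm, compMatrix_apply, Matrix.one_apply, Matrix.add_apply,
    Matrix.smul_apply, Prod.mk.injEq, smul_eq_mul, ← forall_ne_eq_iff_update_eq, h1]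
  by_cases h : ∀ i, i ≠ j → w i = w' i
  · simp only [eq_true h, and_true, if_true, mul_one, and_comm (a := w j = a')]
  · simp [h]

theorem tensorOneHom_splitSnd_R0j (c : ℂ) (j : Fin N) :
    tensorOneHom (splitSnd N) (R0j N c j) = c • 1 + (2 : ℂ) • compMatrix (swap13 j) := by
  rw [R0j_eq]
  ext ⟨a, b, w⟩ ⟨a', b', w'⟩
  by_cases h : b = b' <;>
    simp [tensorOneHom, splitSnd, swap13, compMatrix_apply, Matrix.one_apply, h]

theorem tensorOneHom_splitFst_R0j (c : ℂ) (j : Fin N) :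
    tensorOneHom (splitFst N) (R0j N c j) = c • 1 + (2 : ℂ) • compMatrix (swap23 j) := by
  rw [R0j_eq]
  ext ⟨a, b, w⟩ ⟨a', b', w'⟩
  by_cases h : a = a' <;>
    simp [tensorOneHom, splitFst, swap23, compMatrix_apply, Matrix.one_apply, h]

theorem commute_compMatrix_swap13_swap23 {i j : Fin N} (h : i ≠ j) :
    Commute (compMatrix (swap13 i)) (compMatrix (swap23 j)) := by
  rw [Commute, SemiconjBy, compMatrix_mul, compMatrix_mul]
  congr 1
  ext1 ⟨a, b, w⟩
  simp [swap13, swap23, h, h.symm, Function.update_comm h]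

theorem commute_R0j {i j : Fin N} (h : i ≠ j) (c d : ℂ) :
    Commute (tensorOneHom (splitSnd N) (R0j N c i)) (tensorOneHom (splitFst N) (R0j N d j)) := by
  rw [tensorOneHom_splitSnd_R0j, tensorOneHom_splitFst_R0j]
  refine .add_left (.smul_left (.one_left _) _) (.smul_left (.add_right ?_ (.smul_right ?_ _)) _)
  · exact .smul_right (.one_right _) _
  · exact commute_compMatrix_swap13_swap23 h

theorem compMatrix_swap13_mul_swap23 (j : Fin N) :
    compMatrix (swap13 j) * compMatrix (swap23 j) =
      compMatrix swap12 * compMatrix (swap13 j) := by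
  rw [compMatrix_mul, compMatrix_mul]
  congr 1
  ext1 ⟨a, b, w⟩
  simp [swap12, swap13, swap23]

theorem compMatrix_swap12_mul_self :
    compMatrix (swap12 (N := N)) * compMatrix swap12 = 1 := by
  rw [compMatrix_mul]
  rfl

/-- There are no nonzero antisymmetric tensors in `V₁ ⊗ V₂ ⊗ Vⱼ`, as `dim V = 2 < 3`. -/
theorem antisymmetrizer_eq_zero (j : Fin N) :
    (1 - compMatrix swap12) * (1 - compMatrix (swap13 j) - compMatrix (swap23 j)) = 0 := by
  simp only [sub_mul, mul_sub, one_mul, mul_one, compMatrix_mul]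
  ext p q
  have key : ∀ f g : AAQ N → AAQ N, f p = g p → compMatrix f p q = compMatrix g p q :=
    fun f g h => by rw [compMatrix_apply, compMatrix_apply, h]
  simp only [Matrix.sub_apply, Matrix.zero_apply, ← compMatrix_id]
  obtain ⟨a, b, w⟩ := p
  have h : a = b ∨ a = w j ∨ b = w j := by
    lia
  rcases h with rfl | rfl | rfl
  · rw [key swap12 id rfl, key (swap13 j ∘ swap12) (swap13 j) rfl,
      key (swap23 j ∘ swap12) (swap23 j) rfl]
    ring
  · rw [key (swap13 j) id (by simp [swap13]),
      key (swap13 j ∘ swap12) (swap23 j) (by simp [swap12, swap13, swap23]),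
      key (swap23 j ∘ swap12) swap12 (by simp [swap12, swap23])]
    ring
  · rw [key (swap23 j) id (by simp [swap23]),
      key (swap13 j ∘ swap12) swap12 (by simp [swap12, swap13]),
      key (swap23 j ∘ swap12) (swap13 j) (by simp [swap12, swap13, swap23])]
    ring

theorem PminusW_mul_R0j_mul_R0j (u x : ℂ) (j : Fin N) :
    PminusW N * (tensorOneHom (splitSnd N) (R0j N (u - 1 - x) j) *
      tensorOneHom (splitFst N) (R0j N (u + 1 - x) j)) =
      ((u - x + 3) * (u - x - 1)) • PminusW N := by
  rw [tensorOneHom_splitSnd_R0j, tensorOneHom_splitFst_R0j, PminusW_eq]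
  have hz := antisymmetrizer_eq_zero j
  have hc := compMatrix_swap13_mul_swap23 j
  have hs := compMatrix_swap12_mul_self (N := N)
  generalize compMatrix (swap12 (N := N)) = A at *
  generalize compMatrix (swap13 j) = B at *
  generalize compMatrix (swap23 j) = C at *
  have hABC : (1 - A) * (B * C) = -((1 - A) * B) := by
    rw [hc, ← mul_assoc, sub_mul, hs, one_mul, ← neg_sub, neg_mul]
  have hC : (1 - A) * C = (1 - A) - (1 - A) * B := by
    rw [mul_sub, mul_sub, mul_one, sub_eq_zero] at hz
    exact hz.symm
  have hexp : ((u - 1 - x) • (1 : Matrix (AAQ N) (AAQ N) ℂ) + (2 : ℂ) • B) *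
      ((u + 1 - x) • 1 + (2 : ℂ) • C) = ((u - 1 - x) * (u + 1 - x)) • 1 + (2 * (u + 1 - x)) • B +
        (2 * (u - 1 - x)) • C + (4 : ℂ) • (B * C) := by
    simp only [add_mul, mul_add, smul_mul_assoc, mul_smul_comm, one_mul, mul_one]
    module
  rw [hexp, smul_mul_assoc]
  simp only [mul_add (1 - A), mul_smul_comm, hABC, hC, mul_one]
  module

theorem PminusW_mul_list_prod (y : Fin N → ℂ) (u : ℂ) {l : List (Fin N)} (hl : l.Nodup) :
    PminusW N * (tensorOneHom (splitSnd N) (l.map fun j => R0j N (u - 1 - y j) j).prod *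
      tensorOneHom (splitFst N) (l.map fun j => R0j N (u + 1 - y j) j).prod) =
      (l.map fun j => (u - y j + 3) * (u - y j - 1)).prod • PminusW N := by
  induction l with
  | nil => simp
  | cons j l ih =>
    obtain ⟨hj, hl⟩ := List.nodup_cons.mp hl
    have hcomm : Commute
        (tensorOneHom (splitSnd N) (l.map fun i => R0j N (u - 1 - y i) i).prod)
        (tensorOneHom (splitFst N) (R0j N (u + 1 - y j) j)) := by
      rw [map_list_prod]
      refine Commute.list_prod_left _ _ fun M hM => ?_
      simp only [List.map_map, List.mem_map, Function.comp_apply] at hM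
      obtain ⟨i, hi, rfl⟩ := hM
      exact commute_R0j (ne_of_mem_of_not_mem hi hj) _ _
    simp only [List.map_cons, List.prod_cons, map_mul]
    rw [hcomm.mul_mul_mul_comm, ← mul_assoc, PminusW_mul_R0j_mul_R0j,
      smul_mul_assoc, ih hl, smul_smul]

theorem mono_eq (y : Fin N → ℂ) (u : ℂ) :
    mono N y u = ((List.finRange N).reverse.map fun j => R0j N (u - y j) j).prod := by
  rw [mono, List.ofFn_eq_map, List.map_reverse]

theorem PminusW_mul_self : PminusW N * PminusW N = PminusW N := by
  rw [PminusW_eq]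
  simp only [smul_mul_assoc, mul_smul_comm, sub_mul, mul_sub, one_mul, mul_one,
    compMatrix_swap12_mul_self]
  module

/-- for `k = 2` the quantum determinant of the monodromy matrix is the
explicit central scalar:
`(P⁻ ⊗ id) 𝒯₁₃(u−1) 𝒯₂₃(u+1) (P⁻ ⊗ id) = (∏ⱼ (u−yⱼ+3)(u−yⱼ−1)) • (P⁻ ⊗ id)`. -/
theorem quantum_determinant (N : ℕ) (hN : 1 ≤ N) (y : Fin N → ℂ) (u : ℂ) :
    PminusW N * T13 N y (u - 1) * T23 N y (u + 1) * PminusW N =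
      (∏ j : Fin N, ((u - y j + 3) * (u - y j - 1))) • PminusW N := by
  have h := PminusW_mul_list_prod y u (List.nodup_reverse.mpr (List.nodup_finRange N))
  rw [← mono_eq, ← mono_eq, ← T13_eq, ← T23_eq, List.map_reverse, List.prod_reverse,
    ← List.ofFn_eq_map, List.prod_ofFn] at h
  rw [mul_assoc (PminusW N), h, smul_mul_assoc, PminusW_mul_self]

end
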